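/- Let α ∈ (0,1], let a ≥ 0, and let f : ℝ → ℝ be continuous on [a, ∞). Define F(t) = ∫_a^t f(x)·x^{α−1} dx for t ≥ a. Then for every t > a, F is left α-conformably differentiable (based at 0) at t and (T_α F)(t) = f(t). -/

import Mathlib

open intervalIntegral

/-- The left `α`-conformable derivative of `f : ℝ → ℝ` at `t` based at `0`. -/
def HasConfDerivAt (α : ℝ) (f : ℝ → ℝ) (t L : ℝ) : Prop :=
  Filter.Tendsto (fun ε : ℝ => (f (t + ε * t ^ (1 - α)) - f t) / ε)
    (nhdsWithin 0 {(0 : ℝ)}ᶜ) (nhds L)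

/-- A differentiable function is conformably differentiable, with `T_α F t = t ^ (1 - α) * F' t`. -/
theorem HasDerivAt.hasConfDerivAt {F : ℝ → ℝ} {F' t : ℝ} (hF : HasDerivAt F F' t) (α : ℝ) :
    HasConfDerivAt α F t (F' * t ^ (1 - α)) := by
  have hline : HasDerivAt (fun ε : ℝ => t + ε * t ^ (1 - α)) (t ^ (1 - α)) 0 := by
    simpa using ((hasDerivAt_id (0 : ℝ)).mul_const (t ^ (1 - α))).const_add t
  have hcomp : HasDerivAt (fun ε : ℝ => F (t + ε * t ^ (1 - α))) (F' * t ^ (1 - α)) 0 :=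
    HasDerivAt.comp (h₂ := F) 0 (by simpa using hF) hline
  simpa [HasConfDerivAt, div_eq_inv_mul] using hcomp.tendsto_slope_zero

theorem conf_deriv_integral (α : ℝ) (hα : α ∈ Set.Ioc (0 : ℝ) 1)
    (a : ℝ) (ha : 0 ≤ a) (f : ℝ → ℝ)
    (hf : ContinuousOn f (Set.Ici a)) :
    ∀ t : ℝ, a < t →
      HasConfDerivAt α (fun u => ∫ x in a..u, f x * x ^ (α - 1)) t (f t) := by
  intro t hat
  have ht : 0 < t := ha.trans_lt hat
  have hint : IntervalIntegrable (fun x => f x * x ^ (α - 1)) MeasureTheory.volume a t := by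
    refine (intervalIntegrable_rpow' (by linarith [hα.1])).continuousOn_mul (hf.mono ?_)
    rw [Set.uIcc_of_le hat.le]
    exact Set.Icc_subset_Ici_self
  have hcont : ContinuousOn (fun x => f x * x ^ (α - 1)) (Set.Ioi a) :=
    (hf.mono Set.Ioi_subset_Ici_self).mul <| continuousOn_id.rpow_const fun x hx =>
      Or.inl (ha.trans_lt hx).ne'
  have hF : HasDerivAt (fun u => ∫ x in a..u, f x * x ^ (α - 1)) (f t * t ^ (α - 1)) t :=
    integral_hasDerivAt_right hint (hcont.stronglyMeasurableAtFilter isOpen_Ioi t hat)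
      (hcont.continuousAt (Ioi_mem_nhds hat))
  have hpow : t ^ (α - 1) * t ^ (1 - α) = 1 := by
    rw [← Real.rpow_add ht, sub_add_sub_cancel, sub_self, Real.rpow_zero]
  simpa [mul_assoc, hpow] using hF.hasConfDerivAt α
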